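/- Let s ∈ (0,1). For every u ∈ C^∞_c(ℝ) with support contained in (0,∞), the sharp fractional Hardy inequality holds: (c_{1,s}/2) ∫_ℝ∫_ℝ (u(x)−u(y))²/|x−y|^{1+2s} dx dy ≥ (Γ((2s+1)/2)²/π) ∫_ℝ |x|^{−2s} u(x)² dx. -/

import Mathlib

open MeasureTheory Real Filter Topology Set

noncomputable section

/-- The normalization constant `c_{N,s}` of the fractional Laplacian. -/
def cNs (N : ℕ) (s : ℝ) : ℝ :=
  s * 4 ^ s * Real.Gamma ((N : ℝ) / 2 + s) / (Real.pi ^ ((N : ℝ) / 2) * Real.Gamma (1 - s))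

/-- The Beta integrand is integrable on `(0, 1)`. -/
theorem integrableOn_beta_kernel {a b : ℝ} (ha : 0 < a) (hb : 0 < b) :
    IntegrableOn (fun t : ℝ => t ^ (a - 1) * (1 - t) ^ (b - 1)) (Ioo 0 1) ∧
      ∫ t in Ioo (0:ℝ) 1, t ^ (a - 1) * (1 - t) ^ (b - 1) = ProbabilityTheory.beta a b := by
  have hB := ProbabilityTheory.beta_pos ha hb
  have h1 := ProbabilityTheory.lintegral_betaPDF_eq_one ha hb
  rw [ProbabilityTheory.lintegral_betaPDF] at h1
  have hnn : 0 ≤ᵐ[volume.restrict (Ioo (0:ℝ) 1)]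
      fun t : ℝ => 1 / ProbabilityTheory.beta a b * t ^ (a - 1) * (1 - t) ^ (b - 1) := by
    filter_upwards [ae_restrict_mem measurableSet_Ioo] with t ht
    have := sub_pos.2 ht.2
    have := ht.1
    simp only [Pi.zero_apply]
    positivity
  have hm : AEStronglyMeasurable
      (fun t : ℝ => 1 / ProbabilityTheory.beta a b * t ^ (a - 1) * (1 - t) ^ (b - 1))
      (volume.restrict (Ioo (0:ℝ) 1)) := by
    apply Measurable.aestronglyMeasurable
    fun_prop
  have hint : IntegrableOn
      (fun t : ℝ => 1 / ProbabilityTheory.beta a b * t ^ (a - 1) * (1 - t) ^ (b - 1))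
      (Ioo 0 1) := by
    refine (lintegral_ofReal_ne_top_iff_integrable hm hnn).1 ?_
    rw [h1]; simp
  have hval := integral_eq_lintegral_of_nonneg_ae hnn hm
  rw [h1] at hval
  constructor
  · refine (hint.const_mul (ProbabilityTheory.beta a b)).congr (Eventually.of_forall fun t => ?_)
    field_simp
  · have : ∀ t : ℝ, 1 / ProbabilityTheory.beta a b * t ^ (a - 1) * (1 - t) ^ (b - 1)
        = (ProbabilityTheory.beta a b)⁻¹ * (t ^ (a - 1) * (1 - t) ^ (b - 1)) := by
      intro t; ring
    simp only [this, integral_const_mul] at hval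
    field_simp at hval
    simpa using hval

/-- The quadratic substitution `r = 4 * t / (1 + t)²` in the Beta integral. -/
theorem integral_beta_quadratic_substitution {s : ℝ} (hs : s ∈ Ioo (0:ℝ) 1) :
    IntegrableOn (fun t : ℝ => t ^ (s - 1/2) * (1 - t) ^ (1 - 2 * s) / (1 + t) ^ 2) (Ioo 0 1) ∧
      ∫ t in Ioo (0:ℝ) 1, t ^ (s - 1/2) * (1 - t) ^ (1 - 2 * s) / (1 + t) ^ 2 =
        ProbabilityTheory.beta (s + 1/2) (1 - s) / (2 * 4 ^ s) := by
  obtain ⟨hs0, hs1⟩ := hs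
  obtain ⟨hi, hv⟩ := integrableOn_beta_kernel (a := s + 1/2) (b := 1 - s) (by linarith) (by linarith)
  set f : ℝ → ℝ := fun t => 4 * t / (1 + t) ^ 2 with hf
  set f' : ℝ → ℝ := fun t => 4 * (1 - t) / (1 + t) ^ 3 with hf'
  have hder : ∀ t ∈ Ioo (0:ℝ) 1, HasDerivWithinAt f (f' t) (Ioo 0 1) t := by
    intro t ht
    have h0 : (1 + t) ≠ 0 := by linarith [ht.1]
    have h1 : HasDerivAt (fun t : ℝ => 4 * t) 4 t := by
      simpa using (hasDerivAt_id t).const_mul (4:ℝ)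
    have h2 : HasDerivAt (fun t : ℝ => (1 + t) ^ 2) (2 * (1 + t)) t := by
      simpa using ((hasDerivAt_id t).const_add (1:ℝ)).fun_pow 2
    refine HasDerivAt.hasDerivWithinAt ?_
    convert! h1.div h2 (pow_ne_zero 2 h0) using 1
    simp only [hf']
    field_simp
    ring
  have hinj : InjOn f (Ioo 0 1) := by
    intro x hx y hy hxy
    simp only [hf] at hxy
    have hx0 : (1 + x) ≠ 0 := by linarith [hx.1]
    have hy0 : (1 + y) ≠ 0 := by linarith [hy.1]
    rw [div_eq_div_iff (by positivity) (by positivity)] at hxy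
    have : (x - y) * (1 - x * y) = 0 := by linarith
    rcases mul_eq_zero.1 this with h | h
    · linarith
    · nlinarith [hx.1, hx.2, hy.1, hy.2]
  have himg : f '' Ioo 0 1 = Ioo 0 1 := by
    ext r
    constructor
    · rintro ⟨t, ht, rfl⟩
      have := ht.1
      refine ⟨by simp only [hf]; positivity, ?_⟩
      simp only [hf]
      rw [div_lt_one (by positivity)]
      nlinarith [mul_pos (sub_pos.2 ht.2) (sub_pos.2 ht.2)]
    · intro hr
      have hq0 : 0 < √(1 - r) := Real.sqrt_pos.2 (by linarith [hr.2])
      have hqq : √(1 - r) ^ 2 = 1 - r := Real.sq_sqrt (by linarith [hr.2])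
      have hq1 : √(1 - r) < 1 := by nlinarith [hr.1]
      refine ⟨(1 - √(1 - r)) / (1 + √(1 - r)), ⟨div_pos (by linarith) (by linarith), ?_⟩, ?_⟩
      · rw [div_lt_one (by linarith)]; linarith
      · simp only [hf]
        generalize √(1 - r) = q at *
        have : (1 : ℝ) + (1 - q) / (1 + q) = 2 / (1 + q) := by field_simp; ring
        rw [this]
        field_simp
        linarith
  have hkey : ∀ t ∈ Ioo (0:ℝ) 1,
      |f' t| • (f t ^ (s + 1/2 - 1) * (1 - f t) ^ (1 - s - 1)) =
        (2 * 4 ^ s) * (t ^ (s - 1/2) * (1 - t) ^ (1 - 2 * s) / (1 + t) ^ 2) := by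
    intro t ht
    have ht0 := ht.1
    have ht1 : 0 < 1 - t := sub_pos.2 ht.2
    have hp : 0 < 1 + t := by linarith
    have e1 : 1 - f t = ((1 - t) / (1 + t)) ^ (2:ℝ) := by
      simp only [hf]; norm_num; field_simp; ring
    have e2 : |f' t| = 4 * (1 - t) / (1 + t) ^ 3 := abs_of_pos (by simp only [hf']; positivity)
    have e3 : f t = 4 * t / (1 + t) ^ (2:ℝ) := by simp [hf]
    rw [e1, e2, e3, smul_eq_mul, ← Real.rpow_mul (by positivity),
      Real.div_rpow (by positivity) (by positivity), Real.div_rpow (by positivity) (by positivity),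
      Real.mul_rpow (by positivity) (by positivity), ← Real.rpow_mul (by positivity)]
    have a1 : (4:ℝ) ^ (s + 1/2 - 1) = 4 ^ s / 2 := by
      rw [show s + 1/2 - 1 = s - 1/2 by ring, Real.rpow_sub (by norm_num)]
      congr 1
      rw [← Real.sqrt_eq_rpow, show (4:ℝ) = 2 ^ 2 by norm_num]; simp
    have a2 : (1 - t) ^ (1 - 2 * s) = (1 - t) * (1 - t) ^ (2 * (1 - s - 1)) := by
      rw [show 1 - 2 * s = 1 + 2 * (1 - s - 1) by ring, Real.rpow_add ht1, Real.rpow_one]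
    have a3 : (1 + t) ^ (2 * (s + 1/2 - 1)) = (1 + t) ^ (2 * s) / (1 + t) := by
      rw [show 2 * (s + 1/2 - 1) = 2 * s - 1 by ring, Real.rpow_sub hp, Real.rpow_one]
    have a4 : (1 + t) ^ (2 * (1 - s - 1)) = ((1 + t) ^ (2 * s))⁻¹ := by
      rw [show 2 * (1 - s - 1) = -(2 * s) by ring, Real.rpow_neg hp.le]
    rw [a1, a2, a3, a4, show s + 1/2 - 1 = s - 1/2 by ring]
    field_simp
    ring
  rw [← himg, integrableOn_image_iff_integrableOn_abs_deriv_smul measurableSet_Ioo hder hinj] at hi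
  rw [← himg, integral_image_eq_integral_abs_deriv_smul measurableSet_Ioo hder hinj,
    setIntegral_congr_fun measurableSet_Ioo hkey, integral_const_mul] at hv
  have hi' := hi.congr_fun hkey measurableSet_Ioo
  have h4 : (2 * 4 ^ s : ℝ) ≠ 0 := by positivity
  refine ⟨?_, ?_⟩
  · refine (hi'.const_mul (2 * 4 ^ s : ℝ)⁻¹).congr (Eventually.of_forall fun t => ?_)
    field_simp
  · rw [← hv]; field_simp

/-- `(1 - t^(s-1/2))²` vanishes quadratically at `1`, with controlled growth at `0`. -/
theorem one_sub_rpow_sq_le {s t : ℝ} (hs : s ∈ Ioo (0:ℝ) 1) (ht : t ∈ Ioo (0:ℝ) 1) :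
    (1 - t ^ (s - 1/2)) ^ 2 ≤ (1 - t) ^ 2 * (1 + t ^ (2 * s - 1)) := by
  obtain ⟨ht0, ht1⟩ := ht
  have hp : 0 < t ^ (2 * s - 1) := Real.rpow_pos_of_pos ht0 _
  have aux : ∀ p : ℝ, 0 ≤ p → p ≤ 1 → (1 - t ^ p) ^ 2 ≤ (1 - t) ^ 2 := by
    intro p h0 h1
    have a : t ≤ t ^ p := by
      simpa using Real.rpow_le_rpow_of_exponent_ge ht0 ht1.le h1
    have b : t ^ p ≤ 1 := Real.rpow_le_one ht0.le ht1.le h0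
    nlinarith
  rcases le_total (1/2) s with h | h
  · have := aux (s - 1/2) (by linarith) (by linarith [hs.2])
    nlinarith [mul_nonneg (sq_nonneg (1 - t)) hp.le]
  · have h2 := aux (1/2 - s) (by linarith) (by linarith [hs.1])
    have e1 : t ^ (2 * s - 1) = (t ^ (s - 1/2)) ^ 2 := by
      rw [← Real.rpow_natCast, ← Real.rpow_mul ht0.le]; congr 1; push_cast; ring
    have e2 : t ^ (s - 1/2) * t ^ (1/2 - s) = 1 := by
      rw [← Real.rpow_add ht0]; simp
    have e3 : (1 - t ^ (s - 1/2)) ^ 2 = (t ^ (s - 1/2)) ^ 2 * (1 - t ^ (1/2 - s)) ^ 2 := by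
      linear_combination (2 * t ^ (s - 1/2) - 1 - t ^ (s - 1/2) * t ^ (1/2 - s)) * e2
    rw [e3, ← e1]
    nlinarith [sq_nonneg (1 - t)]

theorem one_sub_sq_mul_rpow {s t : ℝ} (ht : t ∈ Ioo (0:ℝ) 1) :
    (1 - t) ^ 2 * (1 - t) ^ (-1 - 2 * s) = (1 - t) ^ (1 - 2 * s) := by
  have h : 0 < 1 - t := sub_pos.2 ht.2
  rw [← Real.rpow_natCast, ← Real.rpow_add h]; congr 1; push_cast; ring

theorem integrableOn_dominating {s : ℝ} (hs : s ∈ Ioo (0:ℝ) 1) :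
    IntegrableOn (fun t : ℝ => (1 - t) ^ (1 - 2 * s) * (1 + t ^ (2 * s - 1))) (Ioo 0 1) := by
  have h1 := (integrableOn_beta_kernel (a := 1) (b := 2 - 2 * s) one_pos (by linarith [hs.2])).1
  have h2 := (integrableOn_beta_kernel (a := 2 * s) (b := 2 - 2 * s)
    (by linarith [hs.1]) (by linarith [hs.2])).1
  refine (h1.add h2).congr (Eventually.of_forall fun t => ?_)
  simp only [Pi.add_apply]
  rw [show 2 - 2 * s - 1 = 1 - 2 * s by ring]
  simp
  ring

theorem integrableOn_one_sub_rpow_sq {s : ℝ} (hs : s ∈ Ioo (0:ℝ) 1) :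
    IntegrableOn (fun t : ℝ => (1 - t) ^ (-1 - 2 * s) * (1 - t ^ (s - 1/2)) ^ 2) (Ioo 0 1) := by
  refine (integrableOn_dominating hs).mono' (Measurable.aestronglyMeasurable (by fun_prop)) ?_
  filter_upwards [ae_restrict_mem measurableSet_Ioo] with t ht
  have h : 0 < (1 - t) ^ (-1 - 2 * s) := Real.rpow_pos_of_pos (sub_pos.2 ht.2) _
  rw [Real.norm_of_nonneg (by positivity), ← one_sub_sq_mul_rpow ht]
  nlinarith [mul_le_mul_of_nonneg_left (one_sub_rpow_sq_le hs ht) h.le]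

/-- The value of the regularised Beta-type integral behind the sharp Hardy constant. -/
theorem integral_one_sub_rpow_sq {s : ℝ} (hs : s ∈ Ioo (0:ℝ) 1) :
    1 / (2 * s) + ∫ t in Ioo (0:ℝ) 1, (1 - t) ^ (-1 - 2 * s) * (1 - t ^ (s - 1/2)) ^ 2 =
      ProbabilityTheory.beta (s + 1/2) (1 - s) / (2 * s * 4 ^ s) := by
  obtain ⟨hi, hv⟩ := integral_beta_quadratic_substitution hs
  have hj := integrableOn_one_sub_rpow_sq hs
  obtain ⟨hs0, hs1⟩ := hs
  set j : ℝ → ℝ := fun t => (1 - t) ^ (-1 - 2 * s) * (1 - t ^ (s - 1/2)) ^ 2 with hjdef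
  set k : ℝ → ℝ := fun t => t ^ (s - 1/2) * (1 - t) ^ (1 - 2 * s) / (1 + t) ^ 2 with hk
  set F : ℝ → ℝ := fun t => (1 - t) ^ (-(2 * s)) *
    (1 / (2 * s) * (1 + t ^ (2 * s)) - 2 / s * (t ^ (s + 1/2) / (1 + t))) with hF
  have hder : ∀ t ∈ Ioo (0:ℝ) 1, HasDerivAt F (j t - 1 / s * k t) t := by
    intro t ht
    have ht0 := ht.1
    have ht1 : 0 < 1 - t := sub_pos.2 ht.2
    have hp : 0 < 1 + t := by linarith
    have d1 : HasDerivAt (fun t : ℝ => (1 - t) ^ (-(2 * s)))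
        (-1 * (-(2 * s)) * (1 - t) ^ (-(2 * s) - 1)) t :=
      ((hasDerivAt_id t).const_sub 1).rpow_const (Or.inl ht1.ne')
    have d2 : HasDerivAt (fun t : ℝ => t ^ (2 * s)) ((2 * s) * t ^ (2 * s - 1)) t :=
      Real.hasDerivAt_rpow_const (Or.inl ht0.ne')
    have d3 : HasDerivAt (fun t : ℝ => t ^ (s + 1/2)) ((s + 1/2) * t ^ (s + 1/2 - 1)) t :=
      Real.hasDerivAt_rpow_const (Or.inl ht0.ne')
    have d4 : HasDerivAt (fun t : ℝ => 1 + t) 1 t := (hasDerivAt_id t).const_add 1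
    convert! d1.fun_mul (((d2.const_add 1).const_mul (1 / (2 * s))).fun_sub
      ((d3.fun_div d4 hp.ne').const_mul (2 / s))) using 1
    simp only [hjdef, hk]
    have a1 : (1 - t) ^ (-(2 * s)) = (1 - t) * (1 - t) ^ (-1 - 2 * s) := by
      rw [show -(2 * s) = 1 + (-1 - 2 * s) by ring, Real.rpow_add ht1, Real.rpow_one]
    have a2 : t ^ (2 * s) = t * (t ^ (s - 1/2)) ^ 2 := by
      rw [← Real.rpow_natCast, ← Real.rpow_mul ht0.le, show 2 * s = 1 + (s - 1/2) * (2:ℕ) by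
        push_cast; ring, Real.rpow_add ht0, Real.rpow_one]
    have a3 : t ^ (2 * s - 1) = (t ^ (s - 1/2)) ^ 2 := by
      rw [← Real.rpow_natCast, ← Real.rpow_mul ht0.le]; congr 1; push_cast; ring
    have a4 : t ^ (s + 1/2) = t * t ^ (s - 1/2) := by
      rw [show s + 1/2 = 1 + (s - 1/2) by ring, Real.rpow_add ht0, Real.rpow_one]
    rw [← one_sub_sq_mul_rpow ht, a1, a2, a3, a4, show -(2 * s) - 1 = -1 - 2 * s by ring,
      show s + 1/2 - 1 = s - 1/2 by ring]
    field_simp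
    ring
  have hint : IntervalIntegrable (fun t => j t - 1 / s * k t) volume 0 1 :=
    (intervalIntegrable_iff_integrableOn_Ioo_of_le zero_le_one).2 (hj.sub (hi.const_mul _))
  have lim0 : Tendsto F (𝓝[>] 0) (𝓝 (1 / (2 * s))) := by
    have : ContinuousAt F 0 := by
      have h1 : ContinuousAt (fun t : ℝ => (1 - t) ^ (-(2 * s))) 0 :=
        ContinuousAt.rpow_const (by fun_prop) (Or.inl (by norm_num))
      have h2 : ContinuousAt (fun t : ℝ => t ^ (2 * s)) 0 :=
        ContinuousAt.rpow_const (by fun_prop) (Or.inr (by linarith))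
      have h3 : ContinuousAt (fun t : ℝ => t ^ (s + 1/2)) 0 :=
        ContinuousAt.rpow_const (by fun_prop) (Or.inr (by linarith))
      have h4 : ContinuousAt (fun t : ℝ => t ^ (s + 1/2) / (1 + t)) 0 :=
        h3.div (by fun_prop) (by norm_num)
      exact h1.mul ((continuousAt_const.mul (continuousAt_const.add h2)).sub
        (continuousAt_const.mul h4))
    have h0 : F 0 = 1 / (2 * s) := by
      simp only [hF]
      rw [Real.zero_rpow (by linarith), Real.zero_rpow (by linarith)]
      simp
    rw [← h0]
    exact this.tendsto.mono_left nhdsWithin_le_nhds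
  have lim1 : Tendsto F (𝓝[<] 1) (𝓝 0) := by
    have hup : Tendsto (fun t : ℝ => 3 / (2 * s) * (1 - t) ^ (2 - 2 * s)) (𝓝[<] 1) (𝓝 0) := by
      have : ContinuousAt (fun t : ℝ => 3 / (2 * s) * (1 - t) ^ (2 - 2 * s)) 1 :=
        continuousAt_const.mul
          (ContinuousAt.rpow_const (by fun_prop) (Or.inr (by linarith)))
      have h := this.tendsto.mono_left (nhdsWithin_le_nhds (s := Iio 1))
      simpa [Real.zero_rpow (show 2 - 2 * s ≠ 0 by linarith)] using h
    have hev : ∀ᶠ t : ℝ in 𝓝[<] 1, t ∈ Ioo (0:ℝ) 1 := Ioo_mem_nhdsLT zero_lt_one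
    have hrep : ∀ t ∈ Ioo (0:ℝ) 1, 0 ≤ F t ∧ F t ≤ 3 / (2 * s) * (1 - t) ^ (2 - 2 * s) := by
      intro t ht
      have ht0 := ht.1
      have ht1 : 0 < 1 - t := sub_pos.2 ht.2
      have hp : 0 < 1 + t := by linarith
      have a1 : (1 - t) ^ (2 - 2 * s) = (1 - t) ^ 2 * (1 - t) ^ (-(2 * s)) := by
        rw [show 2 - 2 * s = (2:ℕ) + (-(2 * s)) by push_cast; ring, Real.rpow_add ht1,
          Real.rpow_natCast]
      have a2 : t ^ (2 * s) = (t ^ s) ^ 2 := by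
        rw [← Real.rpow_natCast, ← Real.rpow_mul ht0.le]; congr 1; push_cast; ring
      have a3 : t ^ (s + 1/2) = t ^ s * √t := by
        rw [Real.rpow_add ht0, Real.sqrt_eq_rpow]
      have hq : √t ^ 2 = t := Real.sq_sqrt ht0.le
      have hq0 : 0 < √t := Real.sqrt_pos.2 ht0
      have hq1 : t ≤ √t := Real.le_sqrt_of_sq_le (by nlinarith [ht.2])
      have hq2 : √t ≤ 1 := Real.sqrt_le_one.2 ht.2.le
      have hs2 : t ≤ t ^ s := by
        simpa using Real.rpow_le_rpow_of_exponent_ge ht0 ht.2.le hs1.le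
      have hs3 : t ^ s ≤ 1 := Real.rpow_le_one ht0.le ht.2.le hs0.le
      have hs4 : 0 < t ^ s := Real.rpow_pos_of_pos ht0 _
      have hw : 0 < (1 - t) ^ (-(2 * s)) := Real.rpow_pos_of_pos ht1 _
      have e : F t = (1 - t) ^ (-(2 * s)) * (1 / (2 * s) *
          ((1 - t ^ s) ^ 2 + 2 * t ^ s * (1 - √t) ^ 2 / (1 + t))) := by
        simp only [hF]
        rw [a2, a3]
        field_simp
        ring_nf
        rw [hq]
        ring
      refine ⟨by rw [e]; positivity, ?_⟩
      have b1 : (1 - t ^ s) ^ 2 ≤ (1 - t) ^ 2 := by nlinarith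
      have b2 : (1 - √t) ^ 2 ≤ (1 - t) ^ 2 := by nlinarith
      have b3 : 2 * t ^ s * (1 - √t) ^ 2 / (1 + t) ≤ 2 * (1 - t) ^ 2 := by
        rw [div_le_iff₀ hp]
        nlinarith [mul_le_mul hs3 b2 (sq_nonneg _) zero_le_one, mul_nonneg (sq_nonneg (1 - t)) ht0.le]
      rw [e, a1]
      have : (1 - t) ^ (-(2 * s)) * (1 / (2 * s) *
          ((1 - t ^ s) ^ 2 + 2 * t ^ s * (1 - √t) ^ 2 / (1 + t))) ≤
          (1 - t) ^ (-(2 * s)) * (1 / (2 * s) * (3 * (1 - t) ^ 2)) := by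
        gcongr
        linarith
      refine this.trans (le_of_eq ?_)
      ring
    refine tendsto_of_tendsto_of_tendsto_of_le_of_le' tendsto_const_nhds hup ?_ ?_
    · filter_upwards [hev] with t ht using (hrep t ht).1
    · filter_upwards [hev] with t ht using (hrep t ht).2
  have hFTC := intervalIntegral.integral_eq_sub_of_hasDerivAt_of_tendsto zero_lt_one hder hint
    lim0 lim1
  rw [intervalIntegral.integral_of_le zero_le_one, integral_Ioc_eq_integral_Ioo,
    integral_sub hj (hi.const_mul _), integral_const_mul, hv] at hFTC
  have : ∫ t in Ioo (0:ℝ) 1, j t = 1 / s * (ProbabilityTheory.beta (s + 1/2) (1 - s) /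
    (2 * 4 ^ s)) - 1 / (2 * s) := by linarith
  rw [this]
  field_simp
  ring

theorem cNs_one_mul_beta {s : ℝ} (hs : s ∈ Ioo (0:ℝ) 1) :
    cNs 1 s * (ProbabilityTheory.beta (s + 1/2) (1 - s) / (2 * s * 4 ^ s)) =
      Real.Gamma ((2 * s + 1) / 2) ^ 2 / Real.pi := by
  have hs0 := hs.1
  have h1 : 0 < Real.Gamma (1 - s) := Real.Gamma_pos_of_pos (sub_pos.2 hs.2)
  have h2 : Real.Gamma (s + 1/2 + (1 - s)) = √π / 2 := by
    rw [show s + 1/2 + (1 - s) = 1/2 + 1 by ring, Real.Gamma_add_one (by norm_num),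
      Real.Gamma_one_half_eq]
    ring
  have h3 : √π ^ 2 = π := Real.sq_sqrt Real.pi_pos.le
  have h4 : 0 < √π := Real.sqrt_pos.2 Real.pi_pos
  have h5 : (4:ℝ) ^ s ≠ 0 := by positivity
  rw [cNs, ProbabilityTheory.beta, h2, Nat.cast_one, ← Real.sqrt_eq_rpow,
    show (2 * s + 1) / 2 = s + 1/2 by ring, add_comm (1/2) s]
  nth_rw 3 [← h3]
  field_simp

theorem integral_one_sub_rpow_Iic {s : ℝ} (hs : 0 < s) :
    IntegrableOn (fun t : ℝ => (1 - t) ^ (-1 - 2 * s)) (Iic 0) ∧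
      ∫ t in Iic (0:ℝ), (1 - t) ^ (-1 - 2 * s) = 1 / (2 * s) := by
  have himg : (fun t : ℝ => 1 - t) '' Iic 0 = Ici 1 := by simp
  have hder : ∀ t ∈ Iic (0:ℝ), HasDerivWithinAt (fun t : ℝ => 1 - t) (-1) (Iic 0) t :=
    fun t _ => ((hasDerivAt_id t).const_sub 1).hasDerivWithinAt
  have hinj : InjOn (fun t : ℝ => 1 - t) (Iic 0) := fun x _ y _ h => by simpa using h
  have hi := integrableOn_Ioi_rpow_of_lt (a := -1 - 2 * s) (by linarith) one_pos
  have hv := integral_Ioi_rpow_of_lt (a := -1 - 2 * s) (by linarith) one_pos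
  rw [← integrableOn_Ici_iff_integrableOn_Ioi, ← himg,
    integrableOn_image_iff_integrableOn_abs_deriv_smul measurableSet_Iic hder hinj] at hi
  rw [← integral_Ici_eq_integral_Ioi, ← himg,
    integral_image_eq_integral_abs_deriv_smul measurableSet_Iic hder hinj] at hv
  simp only [abs_neg, abs_one, one_smul] at hi hv
  refine ⟨hi, hv.trans ?_⟩
  rw [Real.one_rpow, show -1 - 2 * s + 1 = -(2 * s) by ring, neg_div_neg_eq]

/-- The scaled energy `∫₀^∞ (u(x) - u(tx))² x^{-2s} dx`. -/
def dilationEnergy (s : ℝ) (u : ℝ → ℝ) (t : ℝ) : ℝ :=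
  ∫ x in Ioi (0:ℝ), (u x - u (t * x)) ^ 2 * x ^ (-(2 * s))

theorem integrableOn_mul_rpow_of_eq_zero {v : ℝ → ℝ} (hv : Continuous v) {a b : ℝ} (ha : 0 < a)
    (h1 : ∀ x, 0 < x → x ≤ a → v x = 0) (h2 : ∀ x, b ≤ x → v x = 0) (p : ℝ) :
    IntegrableOn (fun x => v x * x ^ p) (Ioi 0) := by
  have : IntegrableOn (fun x => v x * x ^ p) (Icc a b) := by
    apply ContinuousOn.integrableOn_Icc
    exact hv.continuousOn.mul (continuousOn_id.rpow_const fun x hx => Or.inl (ha.trans_le hx.1).ne')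
  refine this.of_forall_sdiff_eq_zero measurableSet_Ioi fun x hx => ?_
  have hx0 : 0 < x := hx.1
  rcases le_or_gt x a with h | h
  · simp [h1 x hx0 h]
  · rcases le_or_gt b x with h' | h'
    · simp [h2 x h']
    · exact absurd ⟨h.le, h'.le⟩ hx.2

section HalfLine

variable {s : ℝ} {u : ℝ → ℝ} {δ R : ℝ}

theorem integrableOn_sq_mul_rpow (hu : Continuous u) (hδ : 0 < δ) (h1 : ∀ x, x ≤ δ → u x = 0)
    (h2 : ∀ x, R ≤ x → u x = 0) :
    IntegrableOn (fun x => u x ^ 2 * x ^ (-(2 * s))) (Ioi 0) :=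
  integrableOn_mul_rpow_of_eq_zero (b := R) (v := fun x => u x ^ 2) (hu.pow 2) hδ
    (fun x _ hx => by simp [h1 x hx]) (fun x hx => by simp [h2 x hx]) _

theorem integrableOn_sq_comp_mul_rpow (hu : Continuous u) (hδ : 0 < δ)
    (h1 : ∀ x, x ≤ δ → u x = 0) (h2 : ∀ x, R ≤ x → u x = 0) {t : ℝ} (ht : t ∈ Ioo (0:ℝ) 1) :
    IntegrableOn (fun x => u (t * x) ^ 2 * x ^ (-(2 * s))) (Ioi 0) := by
  refine integrableOn_mul_rpow_of_eq_zero (b := R / t) (v := fun x => u (t * x) ^ 2) (by fun_prop) hδ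
    (fun x hx0 hx => ?_) (fun x hx => ?_) _
  · rw [h1 _ (by nlinarith [ht.1, ht.2])]; simp
  · rw [h2 _ (by rwa [div_le_iff₀' ht.1] at hx)]; simp

theorem integrableOn_dilation_sq (hu : Continuous u) (hδ : 0 < δ) (h1 : ∀ x, x ≤ δ → u x = 0)
    (h2 : ∀ x, R ≤ x → u x = 0) {t : ℝ} (ht : t < 1) :
    IntegrableOn (fun x => (u x - u (t * x)) ^ 2 * x ^ (-(2 * s))) (Ioi 0) := by
  rcases le_or_gt t 0 with h | h
  · refine (integrableOn_sq_mul_rpow (s := s) hu hδ h1 h2).congr_fun (fun x hx => ?_)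
      measurableSet_Ioi
    have hx0 : 0 < x := hx
    simp [h1 (t * x) (by nlinarith)]
  · refine integrableOn_mul_rpow_of_eq_zero (b := max R (R / t)) (v := fun x => (u x - u (t * x)) ^ 2)
      (by fun_prop) hδ (fun x hx0 hx => ?_) (fun x hx => ?_) _
    · rw [h1 _ hx, h1 _ (by nlinarith)]; simp
    · have hx' := (le_max_right _ _).trans hx
      rw [div_le_iff₀' h] at hx'
      rw [h2 _ ((le_max_left _ _).trans hx), h2 _ hx']; simp

theorem integral_sq_comp_mul_rpow {t : ℝ} (ht : 0 < t) :
    ∫ x in Ioi (0:ℝ), u (t * x) ^ 2 * x ^ (-(2 * s)) =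
      t ^ (2 * s - 1) * ∫ x in Ioi (0:ℝ), u x ^ 2 * x ^ (-(2 * s)) := by
  have h := integral_comp_mul_left_Ioi (fun x => u x ^ 2 * x ^ (-(2 * s))) 0 ht
  rw [mul_zero, smul_eq_mul] at h
  have h' : ∫ x in Ioi (0:ℝ), u (t * x) ^ 2 * (t * x) ^ (-(2 * s)) =
      t ^ (-(2 * s)) * ∫ x in Ioi (0:ℝ), u (t * x) ^ 2 * x ^ (-(2 * s)) := by
    rw [← integral_const_mul]
    refine setIntegral_congr_fun measurableSet_Ioi fun x hx => ?_
    have hx0 : 0 < x := hx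
    rw [Real.mul_rpow ht.le hx0.le]
    ring
  rw [h', Real.rpow_neg ht.le] at h
  rw [Real.rpow_sub ht, Real.rpow_one]
  have : 0 < t ^ (2 * s) := Real.rpow_pos_of_pos ht _
  field_simp at h ⊢
  linarith

theorem dilationEnergy_of_nonpos (hδ : 0 < δ) (h1 : ∀ x, x ≤ δ → u x = 0) {t : ℝ} (ht : t ≤ 0) :
    dilationEnergy s u t = ∫ x in Ioi (0:ℝ), u x ^ 2 * x ^ (-(2 * s)) := by
  refine setIntegral_congr_fun measurableSet_Ioi fun x hx => ?_
  have hx0 : 0 < x := hx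
  simp [h1 (t * x) (by nlinarith)]

/-- The ground state inequality at a fixed dilation factor. -/
theorem le_dilationEnergy (hu : Continuous u) (hδ : 0 < δ) (h1 : ∀ x, x ≤ δ → u x = 0)
    (h2 : ∀ x, R ≤ x → u x = 0) {t : ℝ} (ht : t ∈ Ioo (0:ℝ) 1) :
    (1 - t ^ (s - 1/2)) ^ 2 * ∫ x in Ioi (0:ℝ), u x ^ 2 * x ^ (-(2 * s)) ≤
      dilationEnergy s u t := by
  have i1 := integrableOn_sq_mul_rpow (s := s) hu hδ h1 h2
  have i2 := integrableOn_sq_comp_mul_rpow (s := s) hu hδ h1 h2 ht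
  have i3 := integrableOn_dilation_sq (s := s) hu hδ h1 h2 ht.2
  have hw : 0 < t ^ (s - 1/2) := Real.rpow_pos_of_pos ht.1 _
  have e : t ^ (2 * s - 1) = (t ^ (s - 1/2)) ^ 2 := by
    rw [← Real.rpow_natCast, ← Real.rpow_mul ht.1.le]; congr 1; push_cast; ring
  calc (1 - t ^ (s - 1/2)) ^ 2 * ∫ x in Ioi (0:ℝ), u x ^ 2 * x ^ (-(2 * s))
      = ∫ x in Ioi (0:ℝ), ((1 - t ^ (s - 1/2)) * (u x ^ 2 * x ^ (-(2 * s))) +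
          (1 - (t ^ (s - 1/2))⁻¹) * (u (t * x) ^ 2 * x ^ (-(2 * s)))) := by
        rw [integral_add (i1.const_mul _) (i2.const_mul _), integral_const_mul,
          integral_const_mul, integral_sq_comp_mul_rpow ht.1, e]
        generalize t ^ (s - 1/2) = w at *
        field_simp
        ring
    _ ≤ dilationEnergy s u t := by
        refine setIntegral_mono_on ((i1.const_mul _).add (i2.const_mul _)) i3 measurableSet_Ioi
          fun x hx => ?_
        have hx' : 0 < x ^ (-(2 * s)) := Real.rpow_pos_of_pos hx _
        generalize x ^ (-(2 * s)) = z at *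
        generalize t ^ (s - 1/2) = w at *
        have : (u x - u (t * x)) ^ 2 * z - ((1 - w) * (u x ^ 2 * z) +
            (1 - w⁻¹) * (u (t * x) ^ 2 * z)) = z * (w * u x - u (t * x)) ^ 2 / w := by
          field_simp
          ring
        have h0 : 0 ≤ z * (w * u x - u (t * x)) ^ 2 / w := by positivity
        linarith

theorem dilationEnergy_nonneg (t : ℝ) : 0 ≤ dilationEnergy s u t :=
  setIntegral_nonneg measurableSet_Ioi fun _ hx =>
    mul_nonneg (sq_nonneg _) (Real.rpow_nonneg (le_of_lt hx) _)

theorem exists_dilationEnergy_le (hs : 0 < s) (hu : Continuous u) (hδ : 0 < δ) (hR : 0 < R)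
    (h1 : ∀ x, x ≤ δ → u x = 0) (h2 : ∀ x, R ≤ x → u x = 0) {K : ℝ}
    (hK : ∀ x y, |u x - u y| ≤ K * |x - y|) :
    ∃ C, 0 ≤ C ∧ ∀ t ∈ Ioo (0:ℝ) 1,
      dilationEnergy s u t ≤ C * ((1 - t) ^ 2 * (1 + t ^ (2 * s - 1))) := by
  set I := ∫ x in Ioi (0:ℝ), u x ^ 2 * x ^ (-(2 * s)) with hI
  have hI0 : 0 ≤ I := setIntegral_nonneg measurableSet_Ioi fun x hx =>
    mul_nonneg (sq_nonneg _) (Real.rpow_nonneg (le_of_lt hx) _)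
  set B := K ^ 2 * (2 * R) ^ 2 * δ ^ (-(2 * s)) * (2 * R) with hB
  have hB0 : 0 ≤ B := by positivity
  refine ⟨8 * I + B, by positivity, fun t ht => ?_⟩
  have hw : 0 < t ^ (2 * s - 1) := Real.rpow_pos_of_pos ht.1 _
  have ht1 : 0 < 1 - t := sub_pos.2 ht.2
  rcases le_or_gt t (1/2) with h | h
  · have i1 := integrableOn_sq_mul_rpow (s := s) hu hδ h1 h2
    have i2 := integrableOn_sq_comp_mul_rpow (s := s) hu hδ h1 h2 ht
    have i3 := integrableOn_dilation_sq (s := s) hu hδ h1 h2 ht.2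
    have : dilationEnergy s u t ≤ 2 * I * (1 + t ^ (2 * s - 1)) := by
      calc dilationEnergy s u t ≤ ∫ x in Ioi (0:ℝ), (2 * (u x ^ 2 * x ^ (-(2 * s))) +
            2 * (u (t * x) ^ 2 * x ^ (-(2 * s)))) := by
            refine setIntegral_mono_on i3 ((i1.const_mul _).add (i2.const_mul _))
              measurableSet_Ioi fun x hx => ?_
            have hx' : 0 < x ^ (-(2 * s)) := Real.rpow_pos_of_pos hx _
            nlinarith [mul_nonneg hx'.le (sq_nonneg (u x + u (t * x)))]
        _ = _ := by
            rw [integral_add (i1.const_mul _) (i2.const_mul _), integral_const_mul,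
              integral_const_mul, integral_sq_comp_mul_rpow ht.1]
            ring
    refine this.trans ?_
    have h4 : 1 ≤ 4 * (1 - t) ^ 2 := by nlinarith
    calc 2 * I * (1 + t ^ (2 * s - 1)) ≤ 2 * I * (1 + t ^ (2 * s - 1)) * (4 * (1 - t) ^ 2) :=
          le_mul_of_one_le_right (by positivity) h4
      _ = 8 * I * ((1 - t) ^ 2 * (1 + t ^ (2 * s - 1))) := by ring
      _ ≤ _ := by gcongr; linarith
  · have hres : dilationEnergy s u t =
        ∫ x in Ioo δ (2 * R), (u x - u (t * x)) ^ 2 * x ^ (-(2 * s)) := by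
      refine setIntegral_eq_of_subset_of_forall_sdiff_eq_zero measurableSet_Ioi
        (fun x hx => hδ.trans hx.1) fun x hx => ?_
      have hx0 : 0 < x := hx.1
      rcases le_or_gt x δ with h' | h'
      · rw [h1 x h', h1 (t * x) (by nlinarith [ht.2])]; simp
      · have h'' : 2 * R ≤ x := not_lt.1 fun h'' => hx.2 ⟨h', h''⟩
        rw [h2 x (by linarith), h2 (t * x) (by nlinarith)]; simp
    have hbd : ∀ x ∈ Ioo δ (2 * R), ‖(u x - u (t * x)) ^ 2 * x ^ (-(2 * s))‖ ≤
        (1 - t) ^ 2 * (K ^ 2 * (2 * R) ^ 2 * δ ^ (-(2 * s))) := by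
      intro x hx
      have hx0 : 0 < x := hδ.trans hx.1
      rw [Real.norm_of_nonneg (by positivity)]
      have a1 : x ^ (-(2 * s)) ≤ δ ^ (-(2 * s)) :=
        Real.rpow_le_rpow_of_nonpos hδ hx.1.le (by linarith)
      have a2 : (u x - u (t * x)) ^ 2 ≤ (K * ((1 - t) * x)) ^ 2 := by
        have := hK x (t * x)
        rw [show x - t * x = (1 - t) * x by ring, abs_of_pos (mul_pos ht1 hx0)] at this
        rw [← sq_abs]
        gcongr
      have a3 : x ^ 2 ≤ (2 * R) ^ 2 := by nlinarith [hx.2]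
      calc (u x - u (t * x)) ^ 2 * x ^ (-(2 * s)) ≤ (K * ((1 - t) * x)) ^ 2 * δ ^ (-(2 * s)) := by
            gcongr
        _ = (1 - t) ^ 2 * (K ^ 2 * x ^ 2 * δ ^ (-(2 * s))) := by ring
        _ ≤ _ := by gcongr
    have hle := norm_setIntegral_le_of_norm_le_const (μ := volume) (by simp) hbd
    rw [← hres, Real.norm_of_nonneg (dilationEnergy_nonneg t)] at hle
    have hvol : volume.real (Ioo δ (2 * R)) ≤ 2 * R := by
      rw [Real.volume_real_Ioo]
      exact max_le (by linarith) (by positivity)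
    calc dilationEnergy s u t
        ≤ (1 - t) ^ 2 * (K ^ 2 * (2 * R) ^ 2 * δ ^ (-(2 * s))) * (2 * R) :=
          hle.trans (by gcongr)
      _ = B * ((1 - t) ^ 2 * 1) := by rw [hB]; ring
      _ ≤ (8 * I + B) * ((1 - t) ^ 2 * (1 + t ^ (2 * s - 1))) := by
          gcongr
          · linarith
          · linarith

theorem stronglyMeasurable_dilationEnergy (hu : Continuous u) :
    StronglyMeasurable (dilationEnergy s u) := by
  have hm := hu.measurable
  refine StronglyMeasurable.integral_prod_right (ν := volume.restrict (Ioi (0:ℝ)))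
    (f := fun t x => (u x - u (t * x)) ^ 2 * x ^ (-(2 * s))) ?_
  apply Measurable.stronglyMeasurable
  simp only [Function.uncurry_def]
  fun_prop

theorem integrableOn_weighted_dilationEnergy_Ioo (hs : s ∈ Ioo (0:ℝ) 1) (hu : Continuous u)
    (hδ : 0 < δ) (hR : 0 < R)
    (h1 : ∀ x, x ≤ δ → u x = 0) (h2 : ∀ x, R ≤ x → u x = 0) {K : ℝ}
    (hK : ∀ x y, |u x - u y| ≤ K * |x - y|) :
    IntegrableOn (fun t => (1 - t) ^ (-1 - 2 * s) * dilationEnergy s u t) (Ioo 0 1) := by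
  obtain ⟨C, hC, hb⟩ := exists_dilationEnergy_le hs.1 hu hδ hR h1 h2 hK
  have hm := (stronglyMeasurable_dilationEnergy (s := s) hu).measurable
  refine ((integrableOn_dominating hs).const_mul C).mono'
    (Measurable.aestronglyMeasurable (by fun_prop)) ?_
  filter_upwards [ae_restrict_mem measurableSet_Ioo] with t ht
  have h : 0 < (1 - t) ^ (-1 - 2 * s) := Real.rpow_pos_of_pos (sub_pos.2 ht.2) _
  rw [Real.norm_of_nonneg (mul_nonneg h.le (dilationEnergy_nonneg t)), ← one_sub_sq_mul_rpow ht]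
  nlinarith [mul_le_mul_of_nonneg_left (hb t ht) h.le]

theorem integrableOn_weighted_dilationEnergy_Iio (hs : s ∈ Ioo (0:ℝ) 1) (hu : Continuous u)
    (hδ : 0 < δ) (hR : 0 < R)
    (h1 : ∀ x, x ≤ δ → u x = 0) (h2 : ∀ x, R ≤ x → u x = 0) {K : ℝ}
    (hK : ∀ x y, |u x - u y| ≤ K * |x - y|) :
    IntegrableOn (fun t => (1 - t) ^ (-1 - 2 * s) * dilationEnergy s u t) (Iio 1) ∧
    (∫ x in Ioi (0:ℝ), u x ^ 2 * x ^ (-(2 * s))) *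
        (ProbabilityTheory.beta (s + 1/2) (1 - s) / (2 * s * 4 ^ s)) ≤
      ∫ t in Iio (1:ℝ), (1 - t) ^ (-1 - 2 * s) * dilationEnergy s u t := by
  have hset : Iio (1:ℝ) = Iic 0 ∪ Ioo 0 1 := (Iic_union_Ioo_eq_Iio zero_lt_one).symm
  have hdisj : Disjoint (Iic (0:ℝ)) (Ioo 0 1) :=
    Set.disjoint_left.2 fun x hx hx' => not_lt.2 hx hx'.1
  obtain ⟨j1, j2⟩ := integral_one_sub_rpow_Iic hs.1
  have hI := integrableOn_weighted_dilationEnergy_Ioo hs hu hδ hR h1 h2 hK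
  have hcongr : EqOn (fun t => (1 - t) ^ (-1 - 2 * s) *
        ∫ x in Ioi (0:ℝ), u x ^ 2 * x ^ (-(2 * s)))
      (fun t => (1 - t) ^ (-1 - 2 * s) * dilationEnergy s u t) (Iic 0) := by
    intro t ht
    simp only
    rw [dilationEnergy_of_nonpos hδ h1 ht]
  have hJ : IntegrableOn (fun t => (1 - t) ^ (-1 - 2 * s) * dilationEnergy s u t) (Iic 0) :=
    IntegrableOn.congr_fun (j1.mul_const _) hcongr measurableSet_Iic
  refine ⟨hset ▸ hJ.union hI, ?_⟩
  rw [hset, setIntegral_union hdisj measurableSet_Ioo hJ hI,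
    ← setIntegral_congr_fun measurableSet_Iic hcongr, integral_mul_const, j2,
    ← integral_one_sub_rpow_sq hs, mul_add, mul_comm _ (1 / (2 * s)),
    mul_comm _ (∫ t in Ioo (0:ℝ) 1, _), ← integral_mul_const]
  refine add_le_add le_rfl ?_
  refine setIntegral_mono_on ((integrableOn_one_sub_rpow_sq hs).mul_const _) hI measurableSet_Ioo
    fun t ht => ?_
  rw [mul_assoc]
  exact mul_le_mul_of_nonneg_left (le_dilationEnergy hu hδ h1 h2 ht)
    (Real.rpow_nonneg (sub_pos.2 ht.2).le _)

theorem lintegral_Iio_eq_dilation {x : ℝ} (hx : 0 < x) (g : ℝ → ENNReal) :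
    ∫⁻ y in Iio x, g y = ∫⁻ t in Iio (1:ℝ), ENNReal.ofReal x * g (t * x) := by
  have himg : (fun t : ℝ => t * x) '' Iio 1 = Iio x := by
    ext y
    refine ⟨?_, fun hy => ⟨y / x, (div_lt_one hx).2 hy, div_mul_cancel₀ y hx.ne'⟩⟩
    rintro ⟨t, ht, rfl⟩
    exact mul_lt_of_lt_one_left hx ht
  have hder : ∀ t ∈ Iio (1:ℝ), HasDerivWithinAt (fun t : ℝ => t * x) x (Iio 1) t :=
    fun t _ => by simpa using ((hasDerivAt_id t).mul_const x).hasDerivWithinAt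
  have hinj : InjOn (fun t : ℝ => t * x) (Iio 1) := fun a _ b _ h => mul_right_cancel₀ hx.ne' h
  rw [← himg, lintegral_image_eq_lintegral_abs_deriv_mul measurableSet_Iio hder hinj,
    abs_of_pos hx]

/-- A symmetric double integral is twice its part below the diagonal. -/
theorem lintegral_lintegral_symm_eq {f : ℝ → ℝ → ENNReal} (hf : Measurable (Function.uncurry f))
    (hsymm : ∀ x y, f x y = f y x) :
    ∫⁻ x, ∫⁻ y, f x y = 2 * ∫⁻ x, ∫⁻ y in Iio x, f x y := by
  have hlt : MeasurableSet {p : ℝ × ℝ | p.2 < p.1} := measurableSet_lt measurable_snd measurable_fst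
  have hind : ∀ x, ∫⁻ y in Iio x, f x y =
      ∫⁻ y, {p : ℝ × ℝ | p.2 < p.1}.indicator (Function.uncurry f) (x, y) := by
    intro x
    rw [← lintegral_indicator measurableSet_Iio]
    rfl
  have hmeas : Measurable fun x => ∫⁻ y in Iio x, f x y := by
    simp_rw [hind]
    exact (hf.indicator hlt).lintegral_prod_right'
  have hup : ∫⁻ x, ∫⁻ y in Ioi x, f x y = ∫⁻ x, ∫⁻ y in Iio x, f x y := by
    calc ∫⁻ x, ∫⁻ y in Ioi x, f x y
        = ∫⁻ x, ∫⁻ y, {p : ℝ × ℝ | p.2 < p.1}.indicator (Function.uncurry f) (y, x) := by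
          refine lintegral_congr fun x => ?_
          rw [← lintegral_indicator measurableSet_Ioi]
          refine lintegral_congr fun y => ?_
          simp only [indicator, mem_Ioi, mem_ofPred_eq, Function.uncurry]
          rw [hsymm]
      _ = ∫⁻ y, ∫⁻ x, {p : ℝ × ℝ | p.2 < p.1}.indicator (Function.uncurry f) (y, x) := by
          refine lintegral_lintegral_swap (Measurable.aemeasurable ?_)
          exact (hf.indicator hlt).comp measurable_swap
      _ = _ := by simp_rw [hind]
  have hsplit : ∀ x, ∫⁻ y, f x y = (∫⁻ y in Iio x, f x y) + ∫⁻ y in Ioi x, f x y := by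
    intro x
    rw [← lintegral_add_compl _ (measurableSet_Iic (a := x)), compl_Iic,
      setLIntegral_congr Iio_ae_eq_Iic]
  simp_rw [hsplit]
  rw [lintegral_add_left hmeas, hup, two_mul]

/-- The Gagliardo energy of `u`, written as a superposition of dilation energies. -/
theorem lintegral_gagliardo_eq (hu : Continuous u) (hδ : 0 < δ)
    (h1 : ∀ x, x ≤ δ → u x = 0) (h2 : ∀ x, R ≤ x → u x = 0) :
    ∫⁻ x, ∫⁻ y, ENNReal.ofReal ((u x - u y) ^ 2 / |x - y| ^ (1 + 2 * s)) =
      2 * ∫⁻ t in Iio (1:ℝ), ENNReal.ofReal ((1 - t) ^ (-1 - 2 * s) * dilationEnergy s u t) := by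
  have hm := hu.measurable
  rw [lintegral_lintegral_symm_eq]
  rotate_left
  · simp only [Function.uncurry_def]
    fun_prop
  · intro x y
    rw [abs_sub_comm, ← neg_sub (u y), neg_sq]
  congr 1
  have hrestrict : ∫⁻ x, ∫⁻ y in Iio x, ENNReal.ofReal ((u x - u y) ^ 2 / |x - y| ^ (1 + 2 * s)) =
      ∫⁻ x in Ioi (0:ℝ), ∫⁻ y in Iio x,
        ENNReal.ofReal ((u x - u y) ^ 2 / |x - y| ^ (1 + 2 * s)) := by
    rw [← lintegral_indicator measurableSet_Ioi]
    refine lintegral_congr fun x => ?_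
    by_cases hx : x ∈ Ioi (0:ℝ)
    · rw [indicator_of_mem hx]
    · rw [indicator_of_notMem hx, setLIntegral_congr_fun (g := fun _ => 0) measurableSet_Iio]
      · simp
      · intro y hy
        have hx' : x ≤ 0 := not_lt.1 hx
        have hy' : y < x := hy
        simp [h1 x (by linarith), h1 y (by linarith)]
  rw [hrestrict]
  calc _ = ∫⁻ x in Ioi (0:ℝ), ∫⁻ t in Iio (1:ℝ), ENNReal.ofReal ((1 - t) ^ (-1 - 2 * s) *
        ((u x - u (t * x)) ^ 2 * x ^ (-(2 * s)))) := by
        refine setLIntegral_congr_fun measurableSet_Ioi fun x hx => ?_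
        have hx0 : 0 < x := hx
        rw [lintegral_Iio_eq_dilation hx0]
        refine setLIntegral_congr_fun measurableSet_Iio fun t ht => ?_
        have ht1 : 0 < 1 - t := sub_pos.2 ht
        rw [← ENNReal.ofReal_mul hx0.le, show x - t * x = (1 - t) * x by ring,
          abs_of_pos (mul_pos ht1 hx0), Real.mul_rpow ht1.le hx0.le,
          show -1 - 2 * s = -(1 + 2 * s) by ring, Real.rpow_neg ht1.le, Real.rpow_neg hx0.le,
          Real.rpow_add hx0, Real.rpow_one]
        congr 1
        field_simp
    _ = ∫⁻ t in Iio (1:ℝ), ∫⁻ x in Ioi (0:ℝ), ENNReal.ofReal ((1 - t) ^ (-1 - 2 * s) *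
        ((u x - u (t * x)) ^ 2 * x ^ (-(2 * s)))) := by
        refine lintegral_lintegral_swap (Measurable.aemeasurable ?_)
        simp only [Function.uncurry_def]
        fun_prop
    _ = _ := by
        refine setLIntegral_congr_fun measurableSet_Iio fun t ht => ?_
        have ht1 : 0 < 1 - t := sub_pos.2 ht
        rw [dilationEnergy, ← integral_const_mul, ofReal_integral_eq_lintegral_ofReal]
        · exact (integrableOn_dilation_sq hu hδ h1 h2 ht).const_mul _
        · filter_upwards [ae_restrict_mem measurableSet_Ioi] with x hx
          have hx0 : 0 < x := hx
          simp only [Pi.zero_apply]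
          positivity

theorem integral_gagliardo_eq (hu : Continuous u) (hδ : 0 < δ)
    (h1 : ∀ x, x ≤ δ → u x = 0) (h2 : ∀ x, R ≤ x → u x = 0)
    (hW : IntegrableOn (fun t => (1 - t) ^ (-1 - 2 * s) * dilationEnergy s u t) (Iio 1)) :
    ∫ x, ∫ y, (u x - u y) ^ 2 / |x - y| ^ (1 + 2 * s) =
      2 * ∫ t in Iio (1:ℝ), (1 - t) ^ (-1 - 2 * s) * dilationEnergy s u t := by
  have hm := hu.measurable
  have hL := lintegral_gagliardo_eq (s := s) hu hδ h1 h2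
  have hnn : 0 ≤ᵐ[volume.restrict (Iio (1:ℝ))]
      fun t => (1 - t) ^ (-1 - 2 * s) * dilationEnergy s u t := by
    filter_upwards [ae_restrict_mem measurableSet_Iio] with t ht
    exact mul_nonneg (Real.rpow_nonneg (sub_pos.2 ht).le _) (dilationEnergy_nonneg t)
  rw [← ofReal_integral_eq_lintegral_ofReal hW hnn] at hL
  have hmeas : Measurable fun x =>
      ∫⁻ y, ENNReal.ofReal ((u x - u y) ^ 2 / |x - y| ^ (1 + 2 * s)) := by
    refine Measurable.lintegral_prod_right
      (f := fun x y => ENNReal.ofReal ((u x - u y) ^ 2 / |x - y| ^ (1 + 2 * s))) ?_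
    simp only [Function.uncurry_def]
    fun_prop
  have hinner : ∀ x, ∫ y, (u x - u y) ^ 2 / |x - y| ^ (1 + 2 * s) =
      (∫⁻ y, ENNReal.ofReal ((u x - u y) ^ 2 / |x - y| ^ (1 + 2 * s))).toReal := by
    intro x
    refine integral_eq_lintegral_of_nonneg_ae (Eventually.of_forall fun y => ?_)
      (Measurable.aestronglyMeasurable (by fun_prop))
    simp only [Pi.zero_apply]
    positivity
  simp_rw [hinner]
  rw [integral_toReal hmeas.aemeasurable (ae_lt_top hmeas ?_), hL, ENNReal.toReal_mul,
    ENNReal.toReal_ofReal (integral_nonneg_of_ae hnn), ENNReal.toReal_ofNat]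
  rw [hL]
  exact ENNReal.mul_ne_top (by simp) (by simp)

end HalfLine

/-- sharp fractional Hardy inequality on the half-line, inequality (4.11) of
the paper. For every `s ∈ (0,1)` and every `u ∈ C^∞_c(ℝ)` with support contained in `(0,∞)`,
`(c_{1,s}/2) ∫_ℝ∫_ℝ (u(x)-u(y))²/|x-y|^{1+2s} dx dy ≥ (Γ((2s+1)/2)²/π) ∫_ℝ |x|^{-2s} u(x)² dx`. -/
theorem stmt_11 (s : ℝ) (hs : s ∈ Ioo (0:ℝ) 1)
    (u : ℝ → ℝ) (hu : ContDiff ℝ (⊤ : ℕ∞) u) (husupp : HasCompactSupport u)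
    (hpos : tsupport u ⊆ Ioi (0:ℝ)) :
    (cNs 1 s / 2) * ∫ x : ℝ, ∫ y : ℝ, (u x - u y) ^ 2 / |x - y| ^ (1 + 2 * s) ≥
      Real.Gamma ((2 * s + 1) / 2) ^ 2 / Real.pi * ∫ x : ℝ, u x ^ 2 / |x| ^ (2 * s) := by
  obtain ⟨δ, hδ, hδu⟩ : ∃ δ, 0 < δ ∧ ∀ x, x ≤ δ → u x = 0 := by
    have h0 : (tsupport u)ᶜ ∈ 𝓝 (0:ℝ) :=
      (isClosed_tsupport u).isOpen_compl.mem_nhds fun h => lt_irrefl (0:ℝ) (hpos h)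
    obtain ⟨ε, hε, hb⟩ := Metric.mem_nhds_iff.1 h0
    refine ⟨ε / 2, by positivity, fun x hx => ?_⟩
    refine image_eq_zero_of_notMem_tsupport fun hxt => ?_
    have hx0 : 0 < x := hpos hxt
    refine hb ?_ hxt
    rw [Metric.mem_ball, Real.dist_eq, sub_zero, abs_of_pos hx0]
    linarith
  obtain ⟨R, hR, hRu⟩ : ∃ R, 0 < R ∧ ∀ x, R ≤ x → u x = 0 := by
    obtain ⟨r, hr⟩ := husupp.isCompact.isBounded.subset_closedBall 0
    refine ⟨max r 0 + 1, by positivity, fun x hx => ?_⟩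
    refine image_eq_zero_of_notMem_tsupport fun hxt => ?_
    have h := hr hxt
    rw [Metric.mem_closedBall, Real.dist_eq, sub_zero] at h
    linarith [le_abs_self x, le_max_left r 0]
  obtain ⟨K, hK⟩ := hu.lipschitzWith_of_hasCompactSupport husupp (by simp)
  have hK' : ∀ x y, |u x - u y| ≤ K * |x - y| := fun x y => by
    simpa [Real.dist_eq] using hK.dist_le_mul x y
  obtain ⟨hW, hle⟩ := integrableOn_weighted_dilationEnergy_Iio hs hu.continuous hδ hR hδu hRu hK'
  rw [integral_gagliardo_eq hu.continuous hδ hδu hRu hW]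
  have hI : ∫ x : ℝ, u x ^ 2 / |x| ^ (2 * s) = ∫ x in Ioi (0:ℝ), u x ^ 2 * x ^ (-(2 * s)) := by
    rw [← setIntegral_eq_integral_of_forall_compl_eq_zero (s := Ioi (0:ℝ))]
    · refine setIntegral_congr_fun measurableSet_Ioi fun x hx => ?_
      have hx0 : 0 < x := hx
      rw [abs_of_pos hx0, Real.rpow_neg hx0.le, div_eq_mul_inv]
    · intro x hx
      simp [hδu x ((not_lt.1 hx).trans hδ.le)]
  have hc : 0 ≤ cNs 1 s := by
    have h1 : 0 < Real.Gamma (1 - s) := Real.Gamma_pos_of_pos (sub_pos.2 hs.2)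
    have h2 : 0 < Real.Gamma (((1 : ℕ) : ℝ) / 2 + s) :=
      Real.Gamma_pos_of_pos (by have := hs.1; positivity)
    have := hs.1
    unfold cNs
    positivity
  rw [hI, ← cNs_one_mul_beta hs, ge_iff_le]
  calc _ = cNs 1 s * ((∫ x in Ioi (0:ℝ), u x ^ 2 * x ^ (-(2 * s))) *
        (ProbabilityTheory.beta (s + 1/2) (1 - s) / (2 * s * 4 ^ s))) := by ring
    _ ≤ _ := mul_le_mul_of_nonneg_left hle hc
    _ = _ := by ring
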